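/- Let (X_n) and (Y_n) be sequences of random elements of C[0,1] with ‖X_n − Y_n‖_∞ → 0 almost surely, and suppose that almost surely the random measures ν_n = (1/ln n) Σ_{k=1}^n k^{−1} δ_{Y_k} converge weakly to a fixed probability measure η on C[0,1]. Then almost surely (1/ln n) Σ_{k=1}^n k^{−1} δ_{X_k} converges weakly to η. -/

import Mathlib

open MeasureTheory Filter

open Topology in
/-- Weighted means, normalized by any `a n` keeping the total mass bounded, of a null sequence
tend to zero when the weights have infinite sum. -/
theorem tendsto_weighted_sum_zero {a w d : ℕ → ℝ} {c : ℝ} (hw : ∀ k, 0 ≤ w k)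
    (hw_sum : Tendsto (fun n => ∑ k ∈ Finset.range n, w k) atTop atTop)
    (ha : Tendsto (fun n => a n * ∑ k ∈ Finset.range (n + 1), w k) atTop (𝓝 c))
    (hd : Tendsto d atTop (𝓝 0)) :
    Tendsto (fun n => a n * ∑ k ∈ Finset.range (n + 1), w k * d k) atTop (𝓝 0) := by
  have hlittle : (fun k => w k * d k) =o[atTop] w := by
    simpa using (Asymptotics.isBigO_refl w atTop).mul_isLittleO
      ((Asymptotics.isLittleO_one_iff ℝ).2 hd)
  have hsum := (hlittle.sum_range hw hw_sum).comp_tendsto (tendsto_add_atTop_nat 1)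
  have hmul := (Asymptotics.isBigO_refl a atTop).mul_isLittleO hsum
  exact (Asymptotics.isLittleO_one_iff ℝ).1 (hmul.trans_isBigO (ha.isBigO_one ℝ))

section DiscreteMeasure

variable {E : Type*} [MeasurableSpace E]

/-- The discrete measure with mass `w k` at `x k`, `k ∈ s`, rescaled to total mass one. -/
noncomputable def normalizedDiracSum (w : ℕ → ℝ) (x : ℕ → E) (s : Finset ℕ) : Measure E :=
  ∑ k ∈ s, ENNReal.ofReal (w k / ∑ j ∈ s, w j) • Measure.dirac (x k)

theorem isProbabilityMeasure_normalizedDiracSum {w : ℕ → ℝ} (x : ℕ → E) {s : Finset ℕ}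
    (hw : ∀ k, 0 ≤ w k) (hs : 0 < ∑ k ∈ s, w k) :
    IsProbabilityMeasure (normalizedDiracSum w x s) := by
  constructor
  simp only [normalizedDiracSum, Measure.coe_finsetSum, Finset.sum_apply, Measure.smul_apply,
    measure_univ, smul_eq_mul, mul_one]
  rw [← ENNReal.ofReal_sum_of_nonneg fun k _ => div_nonneg (hw k) hs.le, ← Finset.sum_div,
    div_self hs.ne', ENNReal.ofReal_one]

theorem integral_normalizedDiracSum [MeasurableSingletonClass E] {w : ℕ → ℝ} (x : ℕ → E)
    {s : Finset ℕ} (hw : ∀ k, 0 ≤ w k) (f : E → ℝ) :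
    ∫ y, f y ∂normalizedDiracSum w x s = (∑ k ∈ s, w k * f (x k)) / ∑ k ∈ s, w k := by
  rw [normalizedDiracSum, integral_finsetSum_measure, Finset.sum_div]
  · refine Finset.sum_congr rfl fun k _ => ?_
    rw [integral_smul_measure, integral_dirac, ENNReal.toReal_ofReal
      (div_nonneg (hw k) (Finset.sum_nonneg fun j _ => hw j)), smul_eq_mul, div_mul_eq_mul_div]
  · exact fun k _ => (integrable_dirac (by simp)).smul_measure ENNReal.ofReal_ne_top

end DiscreteMeasure

open Topology in
/-- For weighted empirical measures whose total mass tends to one, convergence of the integrals of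
bounded Lipschitz functions to those of a probability measure implies weak convergence. -/
theorem tendsto_weighted_sum_of_forall_lipschitz {E : Type*} [MetricSpace E] [MeasurableSpace E]
    [BorelSpace E] {a w : ℕ → ℝ} {x : ℕ → E} {s : ℕ → Finset ℕ} (η : Measure E)
    [IsProbabilityMeasure η] (hw : ∀ k, 0 ≤ w k) (hs : ∀ n, 0 < ∑ k ∈ s n, w k)
    (ha : Tendsto (fun n => a n * ∑ k ∈ s n, w k) atTop (𝓝 1))
    (h : ∀ f : BoundedContinuousFunction E ℝ, (∃ L, LipschitzWith L f) →
      Tendsto (fun n => a n * ∑ k ∈ s n, w k * f (x k)) atTop (𝓝 (∫ y, f y ∂η)))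
    (f : BoundedContinuousFunction E ℝ) :
    Tendsto (fun n => a n * ∑ k ∈ s n, w k * f (x k)) atTop (𝓝 (∫ y, f y ∂η)) := by
  let μ : ℕ → ProbabilityMeasure E := fun n =>
    ⟨normalizedDiracSum w x (s n), isProbabilityMeasure_normalizedDiracSum x hw (hs n)⟩
  have hint (g : E → ℝ) (n : ℕ) : ∫ y, g y ∂(μ n : Measure E) =
      (∑ k ∈ s n, w k * g (x k)) / ∑ k ∈ s n, w k := integral_normalizedDiracSum x hw g
  have hμ : Tendsto μ atTop (𝓝 ⟨η, inferInstance⟩) := by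
    refine tendsto_iff_forall_lipschitz_integral_tendsto.2 fun g hg_bdd hg_lip => ?_
    have hg := h ⟨⟨g, hg_lip.choose_spec.continuous⟩, hg_bdd⟩ hg_lip
    have hdiv := hg.div ha one_ne_zero
    rw [div_one] at hdiv
    refine hdiv.congr' ?_
    filter_upwards [ha.eventually_ne one_ne_zero] with n hn
    rw [hint]
    exact mul_div_mul_left _ _ (left_ne_zero_of_mul hn)
  have hf := ha.mul (ProbabilityMeasure.tendsto_iff_forall_integral_tendsto.1 hμ f)
  rw [one_mul] at hf
  refine hf.congr fun n => ?_
  rw [hint, mul_assoc, mul_div_cancel₀ _ (hs n).ne']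

theorem sum_Icc_one_inv_mul (g : ℕ → ℝ) (n : ℕ) :
    ∑ k ∈ Finset.Icc 1 n, (k : ℝ)⁻¹ * g k = ∑ k ∈ Finset.range (n + 1), (k : ℝ)⁻¹ * g k := by
  rw [Finset.range_eq_Ico, Finset.sum_eq_sum_Ico_succ_bot n.succ_pos]
  simp [← Finset.Ico_add_one_right_eq_Icc]

open Topology in
/-- Weak convergence of logarithmic averages of point masses is unaffected by a perturbation of
the points tending to zero. -/
theorem tendsto_log_average_of_dist_tendsto_zero {E : Type*} [MetricSpace E] [MeasurableSpace E]
    [BorelSpace E] {x y : ℕ → E} (η : Measure E) [IsProbabilityMeasure η]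
    (hxy : Tendsto (fun n => dist (x n) (y n)) atTop (𝓝 0))
    (hy : ∀ f : BoundedContinuousFunction E ℝ,
      Tendsto (fun n : ℕ => (Real.log n)⁻¹ * ∑ k ∈ Finset.Icc 1 n, (k : ℝ)⁻¹ * f (y k))
        atTop (𝓝 (∫ z, f z ∂η)))
    (f : BoundedContinuousFunction E ℝ) :
    Tendsto (fun n : ℕ => (Real.log n)⁻¹ * ∑ k ∈ Finset.Icc 1 n, (k : ℝ)⁻¹ * f (x k))
      atTop (𝓝 (∫ z, f z ∂η)) := by
  have hw (k : ℕ) : 0 ≤ (k : ℝ)⁻¹ := by positivity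
  have hw_sum : Tendsto (fun n => ∑ k ∈ Finset.range n, (k : ℝ)⁻¹) atTop atTop :=
    (not_summable_iff_tendsto_nat_atTop_of_nonneg hw).1 Real.not_summable_natCast_inv
  have hmass : Tendsto (fun n : ℕ => (Real.log n)⁻¹ * ∑ k ∈ Finset.range (n + 1), (k : ℝ)⁻¹)
      atTop (𝓝 1) := by
    have h1 := hy (BoundedContinuousFunction.const E 1)
    simp_rw [fun n => sum_Icc_one_inv_mul (fun k => BoundedContinuousFunction.const E 1 (y k)) n]
      at h1
    simpa using h1
  have hlip (g : BoundedContinuousFunction E ℝ) (hg : ∃ L, LipschitzWith L g) :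
      Tendsto (fun n : ℕ => (Real.log n)⁻¹ * ∑ k ∈ Finset.range (n + 1), (k : ℝ)⁻¹ * g (x k))
        atTop (𝓝 (∫ z, g z ∂η)) := by
    obtain ⟨L, hL⟩ := hg
    have hd : Tendsto (fun k => g (x k) - g (y k)) atTop (𝓝 0) := by
      refine squeeze_zero_norm (fun k => ?_) (by simpa using hxy.const_mul (L : ℝ))
      simpa [dist_eq_norm] using hL.dist_le_mul (x k) (y k)
    have hg := (tendsto_weighted_sum_zero hw hw_sum hmass hd).add (hy g)
    rw [zero_add] at hg
    refine hg.congr fun n => ?_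
    rw [sum_Icc_one_inv_mul (fun k => g (y k)), ← mul_add, ← Finset.sum_add_distrib]
    simp [mul_sub]
  simp_rw [fun n => sum_Icc_one_inv_mul (fun k => f (x k)) n]
  rw [← tendsto_add_atTop_iff_nat 1]
  refine tendsto_weighted_sum_of_forall_lipschitz (s := fun n => Finset.range (n + 1 + 1)) η hw
    (fun n => ?_) ((tendsto_add_atTop_iff_nat 1).2 hmass)
    (fun g hg => (tendsto_add_atTop_iff_nat 1).2 (hlip g hg)) f
  exact Finset.sum_pos' (fun k _ => hw k) ⟨1, by simp, by simp⟩

theorem as_clt_transfer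
    {Ω : Type*} [MeasurableSpace Ω] (P : Measure Ω) [IsProbabilityMeasure P]
    [MeasurableSpace C(Set.Icc (0 : ℝ) 1, ℝ)] [BorelSpace C(Set.Icc (0 : ℝ) 1, ℝ)]
    (X Y : ℕ → Ω → C(Set.Icc (0 : ℝ) 1, ℝ))
    (η : Measure C(Set.Icc (0 : ℝ) 1, ℝ)) [IsProbabilityMeasure η]
    (hclose : ∀ᵐ ω ∂P, Tendsto (fun n => ‖X n ω - Y n ω‖) atTop (nhds 0))
    -- a.s. weak convergence of `(1/ln n) Σ_{k≤n} k⁻¹ δ_{Y_k}` to `η`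
    (hY : ∀ᵐ ω ∂P, ∀ f : BoundedContinuousFunction C(Set.Icc (0 : ℝ) 1, ℝ) ℝ,
      Tendsto (fun n : ℕ => (Real.log n)⁻¹ * ∑ k ∈ Finset.Icc 1 n, (k : ℝ)⁻¹ * f (Y k ω))
        atTop (nhds (∫ x, f x ∂η))) :
    ∀ᵐ ω ∂P, ∀ f : BoundedContinuousFunction C(Set.Icc (0 : ℝ) 1, ℝ) ℝ,
      Tendsto (fun n : ℕ => (Real.log n)⁻¹ * ∑ k ∈ Finset.Icc 1 n, (k : ℝ)⁻¹ * f (X k ω))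
        atTop (nhds (∫ x, f x ∂η)) := by
  filter_upwards [hclose, hY] with ω hXY hYω
  exact tendsto_log_average_of_dist_tendsto_zero η (by simpa only [dist_eq_norm] using hXY) hYω
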